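/- Let V : ℝ → ℝ be a real analytic function, let h : ℝ → ℝ be a real analytic function with ∫_{-∞}^{∞} h⁺(t) dt < ∞ where h⁺(t) = max(h(t), 0), and let μ be the Borel probability measure with density dμ(t) = (1/π)·√(h⁺(t)) dt. Suppose the logarithmic potential U^μ(x) = ∫ ln(1/|x−t|) dμ(t) is well defined for every x, and there is a constant F with U^μ(x) + V(x) = F for all x in the support of μ and U^μ(x) + V(x) ≥ F for all x ∈ ℝ. Set f(t) = √(h⁺(t)). Then f·V' is integrable and ∫_{-∞}^{∞} f(t)·V'(t) dt = 0. -/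

import Mathlib

open MeasureTheory Real Filter Set

/-- Truncated Hilbert transform integral at level `ε`:
`(1/π) ∫_{|x-t|>ε} f(t)/(x-t) dt`. -/
noncomputable def truncHilbert (f : ℝ → ℝ) (x ε : ℝ) : ℝ :=
  (1 / Real.pi) * ∫ t in {t : ℝ | ε < |x - t|}, f t / (x - t)

/-- `HilbertAt f x L` : the principal-value Hilbert transform of `f` at `x` exists
and equals `L`. -/
def HilbertAt (f : ℝ → ℝ) (x L : ℝ) : Prop :=
  Filter.Tendsto (fun ε => truncHilbert f x ε) (nhdsWithin 0 (Set.Ioi 0)) (nhds L)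

/-- The support of a Borel measure on `ℝ`: the set of points every neighborhood of
which has positive measure. -/
noncomputable def measSupport (μ : Measure ℝ) : Set ℝ := {x | ∀ U ∈ nhds x, 0 < μ U}

/-- The affine function `x - t + i ε`. -/
noncomputable def kz (t ε x : ℝ) : ℂ := ((x - t : ℝ) : ℂ) + ε * Complex.I

lemma kz_im (t ε x : ℝ) : (kz t ε x).im = ε := by simp [kz]

lemma kz_re (t ε x : ℝ) : (kz t ε x).re = x - t := by simp [kz]

lemma kz_ne (t : ℝ) {ε : ℝ} (hε : ε ≠ 0) (x : ℝ) : kz t ε x ≠ 0 := by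
  intro h
  apply hε
  rw [← kz_im t ε x, h]; simp

lemma kz_slit (t : ℝ) {ε : ℝ} (hε : ε ≠ 0) (x : ℝ) : kz t ε x ∈ Complex.slitPlane := by
  right; rw [kz_im]; exact hε

lemma kz_normSq (t ε x : ℝ) : ‖kz t ε x‖ ^ 2 = (x - t) ^ 2 + ε ^ 2 := by
  rw [← Complex.normSq_eq_norm_sq, Complex.normSq_apply, kz_im, kz_re]; ring

lemma kz_continuous (t ε : ℝ) : Continuous (kz t ε) := by unfold kz; fun_prop

lemma kz_inv_continuous (t : ℝ) {ε : ℝ} (hε : ε ≠ 0) : Continuous fun x => (kz t ε x)⁻¹ :=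
  (kz_continuous t ε).inv₀ (kz_ne t hε)

lemma kz_hasDerivAt (t ε x : ℝ) : HasDerivAt (kz t ε) 1 x := by
  unfold kz
  have h1 : HasDerivAt (fun x : ℝ => ((x - t : ℝ) : ℂ)) ((1 : ℝ) : ℂ) x :=
    ((hasDerivAt_id x).sub_const t).ofReal_comp
  simpa using h1.add_const ((ε : ℂ) * Complex.I)

lemma kz_log_hasDerivAt (t : ℝ) {ε : ℝ} (hε : ε ≠ 0) (x : ℝ) :
    HasDerivAt (fun x => Complex.log (kz t ε x)) ((kz t ε x)⁻¹) x := by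
  have := (kz_hasDerivAt t ε x).clog_real (kz_slit t hε x)
  simpa using this

lemma kz_div_tendsto (t ε : ℝ) {l : Filter ℝ} (hl : Tendsto (fun x : ℝ => x⁻¹) l (nhds 0))
    (h0 : ∀ᶠ x in l, x ≠ 0) :
    Tendsto (fun x : ℝ => kz t ε x * ((x⁻¹ : ℝ) : ℂ)) l (nhds 1) := by
  have h1 : Tendsto (fun x : ℝ => (1 : ℂ) + (-(t : ℂ) + ε * Complex.I) * ((x⁻¹ : ℝ) : ℂ)) l
      (nhds (1 + (-(t : ℂ) + ε * Complex.I) * ((0 : ℝ) : ℂ))) :=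
    (((Complex.continuous_ofReal.tendsto 0).comp hl).const_mul _).const_add _
  simp only [Complex.ofReal_zero, mul_zero, add_zero] at h1
  refine h1.congr' ?_
  filter_upwards [h0] with x hx
  have : (x : ℂ) ≠ 0 := by exact_mod_cast hx
  unfold kz; push_cast; field_simp; ring

lemma kz_log_atTop (t : ℝ) {ε : ℝ} (hε : ε ≠ 0) :
    Tendsto (fun x : ℝ => Complex.log (kz t ε x) - (Real.log x : ℂ)) atTop (nhds 0) := by
  have h1 := kz_div_tendsto t ε tendsto_inv_atTop_zero (eventually_ne_atTop 0)
  have h2 := (continuousAt_clog (x := 1) (by simp)).tendsto.comp h1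
  rw [Complex.log_one] at h2
  refine h2.congr' ?_
  filter_upwards [eventually_gt_atTop 0] with x hx
  simp only [Function.comp]
  rw [mul_comm, Complex.log_ofReal_mul (by positivity) (kz_ne t hε x), Real.log_inv]
  push_cast; ring

lemma kz_atBot_aux (t ε : ℝ) :
    Tendsto (fun x : ℝ => kz t ε x * (((-x)⁻¹ : ℝ) : ℂ)) atBot (nhds (-1)) := by
  have h1 := (kz_div_tendsto t ε tendsto_inv_atBot_zero (eventually_ne_atBot 0)).neg
  refine h1.congr fun x => ?_
  rw [inv_neg]; push_cast; ring

lemma kz_log_atBot_neg (t : ℝ) {ε : ℝ} (hε : ε < 0) :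
    Tendsto (fun x : ℝ => Complex.log (kz t ε x) - (Real.log (-x) : ℂ)) atBot
      (nhds (-(π * Complex.I))) := by
  have h1 := kz_atBot_aux t ε
  have h3 : Tendsto (fun x : ℝ => kz t ε x * (((-x)⁻¹ : ℝ) : ℂ)) atBot
      (nhdsWithin (-1) {z | z.im < 0}) := by
    refine tendsto_nhdsWithin_iff.2 ⟨h1, ?_⟩
    filter_upwards [eventually_lt_atBot 0] with x hx
    have : 0 < (-x)⁻¹ := by have : 0 < -x := by linarith
                            positivity
    simp only [Complex.im_mul_ofReal, kz_im]
    exact mul_neg_of_neg_of_pos hε this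
  have h2 := (Complex.tendsto_log_nhdsWithin_im_neg_of_re_neg_of_im_zero (z := -1)
    (by simp) (by simp)).comp h3
  simp only [norm_neg, norm_one, Real.log_one, Complex.ofReal_zero, zero_sub] at h2
  refine h2.congr' ?_
  filter_upwards [eventually_lt_atBot 0] with x hx
  have : 0 < -x := by linarith
  simp only [Function.comp]
  rw [mul_comm, Complex.log_ofReal_mul (by positivity) (kz_ne t hε.ne x), Real.log_inv]
  push_cast; ring

lemma kz_log_atBot_pos (t : ℝ) {ε : ℝ} (hε : 0 < ε) :
    Tendsto (fun x : ℝ => Complex.log (kz t ε x) - (Real.log (-x) : ℂ)) atBot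
      (nhds (π * Complex.I)) := by
  have h1 := kz_atBot_aux t ε
  have h3 : Tendsto (fun x : ℝ => kz t ε x * (((-x)⁻¹ : ℝ) : ℂ)) atBot
      (nhdsWithin (-1) {z | 0 ≤ z.im}) := by
    refine tendsto_nhdsWithin_iff.2 ⟨h1, ?_⟩
    filter_upwards [eventually_lt_atBot 0] with x hx
    have : 0 < (-x)⁻¹ := by have : 0 < -x := by linarith
                            positivity
    simp only [Complex.im_mul_ofReal, kz_im]
    positivity
  have h2 := (Complex.tendsto_log_nhdsWithin_im_nonneg_of_re_neg_of_im_zero (z := -1)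
    (by simp) (by simp)).comp h3
  simp only [norm_neg, norm_one, Real.log_one, Complex.ofReal_zero, zero_add] at h2
  refine h2.congr' ?_
  filter_upwards [eventually_lt_atBot 0] with x hx
  have : 0 < -x := by linarith
  simp only [Function.comp]
  rw [mul_comm, Complex.log_ofReal_mul (by positivity) (kz_ne t hε.ne' x), Real.log_inv]
  push_cast; ring

lemma kz_inv_memLp (t : ℝ) {ε : ℝ} (hε : ε ≠ 0) : MemLp (fun x => (kz t ε x)⁻¹) 2 volume := by
  rw [memLp_two_iff_integrable_sq_norm (kz_inv_continuous t hε).aestronglyMeasurable]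
  have h1 : Integrable (fun x : ℝ => (1 + ((x - t) / ε) ^ 2)⁻¹) :=
    (integrable_inv_one_add_sq.comp_div hε).comp_sub_right t
  refine (h1.const_mul (ε ^ 2)⁻¹).congr (Eventually.of_forall fun x => ?_)
  simp only [norm_inv, inv_pow, kz_normSq]
  rw [← mul_inv]; congr 1; field_simp; ring

lemma kz_integral (s t : ℝ) {ε δ : ℝ} (hε : 0 < ε) (hδ : 0 < δ) :
    ∫ x, (kz t δ x)⁻¹ * (kz s (-ε) x)⁻¹ =
      2 * π * Complex.I / (((s - t : ℝ) : ℂ) + ((ε + δ : ℝ) : ℂ) * Complex.I) := by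
  set D : ℂ := ((s - t : ℝ) : ℂ) + ((ε + δ : ℝ) : ℂ) * Complex.I with hD
  have hD0 : D ≠ 0 := by
    intro h
    have := congrArg Complex.im h
    simp [hD] at this
    linarith
  have hε' : -ε ≠ 0 := by simp [hε.ne']
  have hder : ∀ x, HasDerivAt (fun x => (Complex.log (kz s (-ε) x) - Complex.log (kz t δ x)) / D)
      ((kz t δ x)⁻¹ * (kz s (-ε) x)⁻¹) x := by
    intro x
    have h := ((kz_log_hasDerivAt s hε' x).sub (kz_log_hasDerivAt t hδ.ne' x)).div_const D
    refine HasDerivAt.congr_deriv h ?_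
    have h1 := kz_ne s hε' x
    have h2 := kz_ne t hδ.ne' x
    field_simp
    simp only [hD, kz]; push_cast; ring
  have hint : Integrable fun x => (kz t δ x)⁻¹ * (kz s (-ε) x)⁻¹ :=
    (kz_inv_memLp t hδ.ne').integrable_mul (kz_inv_memLp s hε')
  have htop : Tendsto (fun x => (Complex.log (kz s (-ε) x) - Complex.log (kz t δ x)) / D) atTop
      (nhds 0) := by
    have := ((kz_log_atTop s hε').sub (kz_log_atTop t hδ.ne')).div_const D
    simp only [sub_sub_sub_cancel_right, sub_zero, zero_div] at this
    exact this
  have hbot : Tendsto (fun x => (Complex.log (kz s (-ε) x) - Complex.log (kz t δ x)) / D) atBot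
      (nhds ((-(π * Complex.I) - π * Complex.I) / D)) := by
    have := ((kz_log_atBot_neg s (neg_lt_zero.2 hε)).sub (kz_log_atBot_pos t hδ)).div_const D
    simp only [sub_sub_sub_cancel_right] at this
    exact this
  rw [integral_of_hasDerivAt_of_tendsto hder hint hbot htop]
  ring

/-- The Cauchy kernel as an element of `L²`. -/
noncomputable def kL (ε t : ℝ) : Lp ℂ 2 (volume : Measure ℝ) :=
  if hε : 0 < ε then (kz_inv_memLp t hε.ne').toLp _ else 0

lemma kL_coe {ε : ℝ} (hε : 0 < ε) (t : ℝ) : kL ε t =ᵐ[volume] fun x => (kz t ε x)⁻¹ := by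
  rw [kL, dif_pos hε]; exact MemLp.coeFn_toLp _

lemma kz_conj (t ε x : ℝ) : (starRingEnd ℂ) (kz t ε x) = kz t (-ε) x := by
  apply Complex.ext <;> simp [kz]

lemma kL_inner {ε δ : ℝ} (hε : 0 < ε) (hδ : 0 < δ) (s t : ℝ) :
    inner ℂ (kL ε s) (kL δ t) =
      2 * π * Complex.I / (((s - t : ℝ) : ℂ) + ((ε + δ : ℝ) : ℂ) * Complex.I) := by
  rw [L2.inner_def, ← kz_integral s t hε hδ]
  apply integral_congr_ae
  filter_upwards [kL_coe hε s, kL_coe hδ t] with x h1 h2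
  rw [h1, h2, RCLike.inner_apply, map_inv₀, kz_conj]

lemma kL_norm_sq {ε : ℝ} (hε : 0 < ε) (t : ℝ) : ‖kL ε t‖ ^ 2 = π / ε := by
  rw [@norm_sq_eq_re_inner ℂ, kL_inner hε hε]
  have : (2 * π * Complex.I / (((t - t : ℝ) : ℂ) + ((ε + ε : ℝ) : ℂ) * Complex.I) : ℂ)
      = ((π / ε : ℝ) : ℂ) := by
    have : (ε : ℂ) ≠ 0 := by exact_mod_cast hε.ne'
    push_cast
    field_simp
    ring_nf
    try field_simp
  rw [this]; simp

lemma kL_continuous {ε : ℝ} (hε : 0 < ε) : Continuous (kL ε) := by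
  rw [continuous_iff_continuousAt]
  intro s
  rw [ContinuousAt, tendsto_iff_norm_sub_tendsto_zero]
  have h1 : ∀ t, ‖kL ε t - kL ε s‖ ^ 2 = 2 * (π / ε) - 2 * (2 * π * Complex.I /
      (((t - s : ℝ) : ℂ) + ((ε + ε : ℝ) : ℂ) * Complex.I)).re := by
    intro t
    rw [@norm_sub_sq ℂ, kL_norm_sq hε, kL_norm_sq hε, kL_inner hε hε, RCLike.re_eq_complex_re]; ring
  have h2 : Continuous fun t : ℝ => ‖kL ε t - kL ε s‖ ^ 2 := by
    simp_rw [h1]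
    refine continuous_const.sub (continuous_const.mul (Complex.continuous_re.comp ?_))
    refine continuous_const.div (by fun_prop) fun t h => ?_
    have := congrArg Complex.im h
    simp at this
    linarith
  have h3 : Continuous fun t : ℝ => ‖kL ε t - kL ε s‖ := by
    have := h2.sqrt
    simpa [Real.sqrt_sq (norm_nonneg _)] using this
  simpa using h3.tendsto s

/-- Autocorrelation. -/
noncomputable def autoC (f : ℝ → ℝ) (u : ℝ) : ℝ := ∫ t, f t * f (u + t)

lemma autoC_continuous {f : ℝ → ℝ} (hf : MemLp f 2 volume) : Continuous (autoC f) := by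
  have h1 : Continuous fun u : ℝ => (DomAddAct.mk u) +ᵥ hf.toLp f := by
    have hk : Continuous fun u : ℝ => DomAddAct.mk u := DomAddAct.continuous_mk
    have : Fact ((2 : ENNReal) ≠ ⊤) := ⟨by simp⟩
    exact hk.vadd continuous_const
  have h2 : Continuous fun u : ℝ => inner ℝ (hf.toLp f) ((DomAddAct.mk u) +ᵥ hf.toLp f) :=
    continuous_const.inner h1
  refine h2.congr fun u => ?_
  rw [L2.inner_def, autoC]
  apply integral_congr_ae
  have h3 := DomAddAct.vadd_Lp_ae_eq (DomAddAct.mk u) (hf.toLp f)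
  have h4 : (fun t => hf.toLp f (u + t)) =ᵐ[volume] fun t => f (u + t) :=
    (measurePreserving_add_left volume u).quasiMeasurePreserving.ae_eq_comp hf.coeFn_toLp
  filter_upwards [h3, h4, hf.coeFn_toLp] with x hx1 hx2 hx3
  rw [hx1, hx3]
  simp only [RCLike.inner_apply, conj_trivial] at hx2 ⊢
  have : hf.toLp f ((DomAddAct.mk.symm (DomAddAct.mk u)) +ᵥ x) = f (u + x) := hx2
  rw [this, mul_comm]

lemma autoC_bound {f : ℝ → ℝ} (hf : MemLp f 2 volume) (u : ℝ) :
    |autoC f u| ≤ ∫ t, f t ^ 2 := by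
  have hu : MemLp (fun t => f (u + t)) 2 volume :=
    hf.comp_measurePreserving (measurePreserving_add_left volume u)
  have h1 : ∫ t, f (u + t) ^ 2 = ∫ t, f t ^ 2 := integral_add_left_eq_self (fun t => f t ^ 2) u
  calc |autoC f u| ≤ ∫ t, |f t * f (u + t)| := abs_integral_le_integral_abs
    _ ≤ ∫ t, (f t ^ 2 + f (u + t) ^ 2) / 2 := by
        apply integral_mono (hf.integrable_mul hu).abs
        · exact (hf.integrable_sq.add hu.integrable_sq).div_const 2
        · intro t
          change |f t * f (u + t)| ≤ _
          rw [abs_le]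
          constructor <;> nlinarith [sq_nonneg (f t - f (u + t)), sq_nonneg (f t + f (u + t))]
    _ = ∫ t, f t ^ 2 := by
        rw [integral_div, integral_add hf.integrable_sq hu.integrable_sq, h1]; ring

/-- Poisson kernel (up to a factor). -/
noncomputable def pk (η u : ℝ) : ℝ := 2 * π * η / (u ^ 2 + η ^ 2)

lemma pk_continuous {η : ℝ} (hη : 0 < η) : Continuous (pk η) := by
  unfold pk
  refine continuous_const.div (by fun_prop) fun u => by positivity

lemma pk_bound {η : ℝ} (hη : 0 < η) (u : ℝ) : ‖pk η u‖ ≤ 2 * π / η := by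
  unfold pk
  rw [Real.norm_of_nonneg (by positivity), div_le_div_iff₀ (by positivity) hη]
  have : 0 ≤ 2 * π * u ^ 2 := by positivity
  nlinarith

/-- The energy. -/
noncomputable def Phi (f : ℝ → ℝ) (η : ℝ) : ℝ := ∫ t, f t * ∫ s, f s * pk η (t - s)

lemma Phi_eq {f : ℝ → ℝ} (hc : Continuous f) (hf : Integrable f) {η : ℝ} (hη : 0 < η) :
    Phi f η = ∫ v, 2 * π * (1 + v ^ 2)⁻¹ * autoC f (η * v) := by
  have e1 : Phi f η = ∫ t, ∫ u, f t * f (t + u) * pk η u := by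
    unfold Phi
    congr 1; ext t
    rw [← integral_const_mul, ← integral_add_left_eq_self _ t]
    congr 1; ext u
    have : pk η (t - (t + u)) = pk η u := by unfold pk; congr 2; ring
    rw [this]; ring
  have hint : Integrable (fun p : ℝ × ℝ => f p.1 * f (p.1 + p.2) * pk η p.2)
      (volume.prod volume) := by
    have h1 : Integrable (fun p : ℝ × ℝ => f p.1 * f p.2) (volume.prod volume) := hf.mul_prod hf
    have h2 := (measurePreserving_prod_add (volume : Measure ℝ) (volume : Measure ℝ)).integrable_comp_of_integrable h1
    refine Integrable.mul_bdd h2 (c := 2 * π / η) ?_ ?_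
    · exact ((pk_continuous hη).comp continuous_snd).aestronglyMeasurable
    · exact Eventually.of_forall fun p => pk_bound hη p.2
  have e2 : ∫ t, ∫ u, f t * f (t + u) * pk η u = ∫ u, pk η u * autoC f u := by
    rw [integral_integral_swap hint]
    congr 1; ext u
    rw [integral_mul_const, mul_comm, autoC]
    simp_rw [add_comm u]
  rw [e1, e2]
  have e3 := Measure.integral_comp_mul_left (fun u => pk η u * autoC f u) η
  rw [abs_of_pos (by positivity), smul_eq_mul] at e3
  have e4 : ∫ u, pk η u * autoC f u = η * ∫ v, pk η (η * v) * autoC f (η * v) := by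
    rw [e3]; field_simp
  rw [e4, ← integral_const_mul]
  congr 1; ext v
  unfold pk
  have : (η * v) ^ 2 + η ^ 2 ≠ 0 := by positivity
  have : 1 + v ^ 2 ≠ 0 := by positivity
  field_simp
  ring

lemma Phi_tendsto {f : ℝ → ℝ} (hc : Continuous f) (hf : Integrable f) (hf2 : MemLp f 2 volume) :
    ∃ L, Tendsto (Phi f) (nhdsWithin 0 (Ioi 0)) (nhds L) := by
  refine ⟨∫ v, 2 * π * (1 + v ^ 2)⁻¹ * autoC f (0 * v), ?_⟩
  have h : Tendsto (fun η : ℝ => ∫ v, 2 * π * (1 + v ^ 2)⁻¹ * autoC f (η * v))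
      (nhdsWithin 0 (Ioi 0)) (nhds (∫ v, 2 * π * (1 + v ^ 2)⁻¹ * autoC f (0 * v))) := by
    have hC := autoC_continuous hf2
    refine tendsto_integral_filter_of_dominated_convergence
      (fun v => 2 * π * (1 + v ^ 2)⁻¹ * ∫ t, f t ^ 2) ?_ ?_ ?_ ?_
    · refine Eventually.of_forall fun η => Continuous.aestronglyMeasurable ?_
      refine Continuous.mul (continuous_const.mul ?_) (hC.comp (by fun_prop))
      exact Continuous.inv₀ (by fun_prop) fun v => by positivity
    · refine Eventually.of_forall fun η => Eventually.of_forall fun v => ?_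
      rw [norm_mul, Real.norm_of_nonneg (by positivity : 0 ≤ 2 * π * (1 + v ^ 2)⁻¹)]
      exact mul_le_mul_of_nonneg_left (autoC_bound hf2 _) (by positivity)
    · exact (integrable_inv_one_add_sq.const_mul _).mul_const _
    · refine Eventually.of_forall fun v => ?_
      refine Tendsto.const_mul _ ?_
      refine tendsto_nhdsWithin_of_tendsto_nhds ?_
      have : Continuous fun η : ℝ => autoC f (η * v) := hC.comp (by fun_prop)
      exact this.tendsto 0
  refine h.congr' ?_
  filter_upwards [self_mem_nhdsWithin] with η hη
  exact (Phi_eq hc hf hη).symm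

/-- The regularized Cauchy transform, as an element of `L²`. -/
noncomputable def CGL (f : ℝ → ℝ) (ε : ℝ) : Lp ℂ 2 (volume : Measure ℝ) :=
  ∫ t, (f t : ℂ) • kL ε t

lemma CGL_integrable {f : ℝ → ℝ} (hc : Continuous f) (hf : Integrable f) {ε : ℝ} (hε : 0 < ε) :
    Integrable fun t => (f t : ℂ) • kL ε t := by
  have hm : Continuous fun t => (f t : ℂ) • kL ε t :=
    (Complex.continuous_ofReal.comp hc).smul (kL_continuous hε)
  refine (hf.norm.mul_const (√(π / ε))).mono' hm.aestronglyMeasurable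
    (Eventually.of_forall fun t => ?_)
  rw [norm_smul, ← kL_norm_sq hε t, Real.sqrt_sq (norm_nonneg _)]
  simp

lemma inner_CGL {f : ℝ → ℝ} (hc : Continuous f) (hf : Integrable f) {ε : ℝ} (hε : 0 < ε)
    (c : Lp ℂ 2 (volume : Measure ℝ)) :
    (inner ℂ c (CGL f ε)).re = ∫ t, f t * (inner ℂ c (kL ε t)).re := by
  have hi := CGL_integrable hc hf hε
  rw [CGL, ← integral_inner hi]
  have := integral_re (hi.const_inner (𝕜 := ℂ) c)
  simp only [RCLike.re_eq_complex_re] at this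
  rw [← this]
  congr 1; ext t
  rw [inner_smul_right, Complex.re_ofReal_mul]

lemma kL_inner_re {ε δ : ℝ} (hε : 0 < ε) (hδ : 0 < δ) (s t : ℝ) :
    (inner ℂ (kL ε s) (kL δ t)).re = pk (ε + δ) (s - t) := by
  rw [kL_inner hε hδ, Complex.div_re]
  simp [Complex.normSq_apply, pk]
  ring

lemma CGL_inner {f : ℝ → ℝ} (hc : Continuous f) (hf : Integrable f) {ε δ : ℝ} (hε : 0 < ε)
    (hδ : 0 < δ) : (inner ℂ (CGL f ε) (CGL f δ)).re = Phi f (ε + δ) := by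
  rw [inner_CGL hc hf hδ, Phi]
  congr 1; ext t
  have : (inner ℂ (CGL f ε) (kL δ t)).re = (inner ℂ (kL δ t) (CGL f ε)).re := by
    rw [← inner_conj_symm, Complex.conj_re]
  rw [this, inner_CGL hc hf hε]
  congr 2; ext s
  rw [kL_inner_re hδ hε, add_comm]

/-- The sequence of regularization parameters. -/
noncomputable def eps (n : ℕ) : ℝ := 1 / ((n : ℝ) + 1)

lemma eps_pos (n : ℕ) : 0 < eps n := by unfold eps; positivity

lemma eps_tendsto : Tendsto eps atTop (nhds 0) := tendsto_one_div_add_atTop_nhds_zero_nat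

lemma CGL_cauchy {f : ℝ → ℝ} (hc : Continuous f) (hf : Integrable f) (hf2 : MemLp f 2 volume) :
    CauchySeq fun n => CGL f (eps n) := by
  obtain ⟨L, hL⟩ := Phi_tendsto hc hf hf2
  rw [cauchySeq_iff_tendsto_dist_atTop_0]
  have h1 : Tendsto (fun p : ℕ × ℕ => eps p.1) atTop (nhds 0) :=
    eps_tendsto.comp (by rw [← prod_atTop_atTop_eq]; exact tendsto_fst)
  have h2 : Tendsto (fun p : ℕ × ℕ => eps p.2) atTop (nhds 0) :=
    eps_tendsto.comp (by rw [← prod_atTop_atTop_eq]; exact tendsto_snd)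
  have key : ∀ {a b : ℕ × ℕ → ℝ}, Tendsto a atTop (nhds 0) → Tendsto b atTop (nhds 0) →
      (∀ p, 0 < a p) → (∀ p, 0 < b p) → Tendsto (fun p => Phi f (a p + b p)) atTop (nhds L) := by
    intro a b ha hb ha' hb'
    refine hL.comp (tendsto_nhdsWithin_iff.2 ⟨by simpa using ha.add hb, ?_⟩)
    exact Eventually.of_forall fun p => add_pos (ha' p) (hb' p)
  have k11 := key h1 h1 (fun p => eps_pos _) (fun p => eps_pos _)
  have k12 := key h1 h2 (fun p => eps_pos _) (fun p => eps_pos _)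
  have k22 := key h2 h2 (fun p => eps_pos _) (fun p => eps_pos _)
  have hs := ((k11.sub (k12.const_mul 2)).add k22).sqrt
  have h0 : √(L - 2 * L + L) = 0 := by ring_nf; simp
  rw [h0] at hs
  refine hs.congr fun p => ?_
  rw [dist_eq_norm, ← Real.sqrt_sq (norm_nonneg (CGL f (eps p.1) - CGL f (eps p.2))),
    @norm_sub_sq ℂ, @norm_sq_eq_re_inner ℂ, @norm_sq_eq_re_inner ℂ]
  simp only [RCLike.re_eq_complex_re]
  rw [CGL_inner hc hf (eps_pos _) (eps_pos _), CGL_inner hc hf (eps_pos _) (eps_pos _),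
    CGL_inner hc hf (eps_pos _) (eps_pos _)]

lemma kz_inv_re (t ε x : ℝ) : ((kz t ε x)⁻¹).re = (x - t) / ((x - t) ^ 2 + ε ^ 2) := by
  rw [Complex.inv_re, Complex.normSq_eq_norm_sq, kz_normSq, kz_re]

/-- Real part of the Cauchy kernel. -/
noncomputable def qk (ε u : ℝ) : ℝ := u / (u ^ 2 + ε ^ 2)

lemma qk_continuous {ε : ℝ} (hε : 0 < ε) : Continuous (qk ε) := by
  unfold qk
  refine continuous_id.div (by fun_prop) fun u => by positivity

lemma qk_bound {ε : ℝ} (hε : 0 < ε) (u : ℝ) : ‖qk ε u‖ ≤ 1 / ε := by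
  unfold qk
  have h0 : 0 < u ^ 2 + ε ^ 2 := by positivity
  rw [norm_div, Real.norm_of_nonneg h0.le, div_le_div_iff₀ h0 hε, Real.norm_eq_abs]
  nlinarith [sq_abs u, sq_nonneg (|u| - ε), abs_nonneg u, sq_nonneg (|u|)]

lemma antisymm_zero {f : ℝ → ℝ} (hf : Integrable f) {ε : ℝ} (hε : 0 < ε) :
    ∫ t, f t * ∫ x, f x * qk ε (x - t) = 0 := by
  have hint : Integrable (fun p : ℝ × ℝ => f p.1 * f p.2 * qk ε (p.2 - p.1))
      (volume.prod volume) := by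
    refine Integrable.mul_bdd (c := 1 / ε) (hf.mul_prod hf) ?_ ?_
    · exact ((qk_continuous hε).comp (by fun_prop)).aestronglyMeasurable
    · exact Eventually.of_forall fun p => qk_bound hε _
  have e1 : ∫ t, f t * ∫ x, f x * qk ε (x - t) = ∫ t, ∫ x, f t * f x * qk ε (x - t) := by
    congr 1; ext t
    rw [← integral_const_mul]
    congr 1; ext x; ring
  have e2 : ∫ t, ∫ x, f t * f x * qk ε (x - t) = - ∫ t, ∫ x, f t * f x * qk ε (x - t) := by
    conv_lhs => rw [integral_integral_swap hint]
    rw [← integral_neg]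
    congr 1; ext x
    rw [← integral_neg]
    congr 1; ext t
    have : qk ε (x - t) = - qk ε (t - x) := by
      unfold qk; rw [← neg_div]; congr 1 <;> ring
    rw [this]; ring
  rw [e1]; linarith

lemma inner_fL {f : ℝ → ℝ} (hc : MemLp (fun x => (f x : ℂ)) 2 volume) {ε : ℝ} (hε : 0 < ε)
    (t : ℝ) : (inner ℂ (hc.toLp _) (kL ε t)).re = ∫ x, f x * qk ε (x - t) := by
  have hi := L2.integrable_inner (𝕜 := ℂ) (hc.toLp _) (kL ε t)
  rw [L2.inner_def]
  have := integral_re hi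
  simp only [RCLike.re_eq_complex_re] at this
  rw [← this]
  apply integral_congr_ae
  filter_upwards [hc.coeFn_toLp, kL_coe hε t] with x h1 h2
  rw [h1, h2, RCLike.inner_apply, Complex.conj_ofReal, Complex.re_mul_ofReal, kz_inv_re, mul_comm, qk]

lemma inner_ind {ε : ℝ} (hε : 0 < ε) (t : ℝ) {a b : ℝ} (hab : a ≤ b) :
    (inner ℂ (indicatorConstLp 2 (measurableSet_Ioc (a := a) (b := b))
      (measure_Ioc_lt_top (μ := volume)).ne (1 : ℂ)) (kL ε t)).re
      = Real.log ‖kz t ε b‖ - Real.log ‖kz t ε a‖ := by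
  rw [L2.inner_indicatorConstLp_one]
  have h1 : ∫ x in Ioc a b, kL ε t x = ∫ x in Ioc a b, (kz t ε x)⁻¹ :=
    integral_congr_ae (ae_restrict_of_ae (kL_coe hε t))
  rw [h1, ← intervalIntegral.integral_of_le hab,
    intervalIntegral.integral_eq_sub_of_hasDerivAt (fun x _ => kz_log_hasDerivAt t hε.ne' x)
      ((kz_inv_continuous t hε.ne').intervalIntegrable _ _), Complex.sub_re, Complex.log_re,
    Complex.log_re]

lemma hilbert_main {f : ℝ → ℝ} (hc : Continuous f) (hf : Integrable f) (hf2 : MemLp f 2 volume) :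
    ∃ r : ℝ → ℝ, MemLp r 2 volume ∧ ∫ x, f x * r x = 0 ∧
      ∀ a b : ℝ, a ≤ b → Tendsto (fun n => ∫ t, f t *
        (Real.log ‖kz t (eps n) b‖ - Real.log ‖kz t (eps n) a‖)) atTop
        (nhds (∫ x in a..b, r x)) := by
  obtain ⟨g, hg⟩ := cauchySeq_tendsto_of_complete (CGL_cauchy hc hf hf2)
  have hinner : ∀ c : Lp ℂ 2 (volume : Measure ℝ), Tendsto
      (fun n => ∫ t, f t * (inner ℂ c (kL (eps n) t)).re) atTop (nhds (inner ℂ c g).re) := by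
    intro c
    have h1 : Tendsto (fun n => (inner ℂ c (CGL f (eps n))).re) atTop (nhds (inner ℂ c g).re) :=
      (Complex.continuous_re.tendsto _).comp (tendsto_const_nhds.inner hg)
    exact h1.congr fun n => inner_CGL hc hf (eps_pos n) c
  refine ⟨fun x => (g x).re, (Lp.memLp g).re, ?_, ?_⟩
  · have hcC : MemLp (fun x => (f x : ℂ)) 2 volume := hf2.ofReal
    have h1 := hinner (hcC.toLp _)
    have h2 : ∀ n, ∫ t, f t * (inner ℂ (hcC.toLp _) (kL (eps n) t)).re = 0 := by
      intro n
      simp_rw [inner_fL hcC (eps_pos n)]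
      exact antisymm_zero hf (eps_pos n)
    simp_rw [h2] at h1
    have h3 := tendsto_nhds_unique h1 tendsto_const_nhds
    rw [← h3, L2.inner_def]
    have hi := L2.integrable_inner (𝕜 := ℂ) (hcC.toLp _) g
    have := integral_re hi
    simp only [RCLike.re_eq_complex_re] at this
    rw [← this]
    apply integral_congr_ae
    filter_upwards [hcC.coeFn_toLp] with x h1
    rw [h1, RCLike.inner_apply, Complex.conj_ofReal, Complex.re_mul_ofReal, mul_comm]
  · intro a b hab
    have h1 := hinner (indicatorConstLp 2 (measurableSet_Ioc (a := a) (b := b))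
      (measure_Ioc_lt_top (μ := volume)).ne (1 : ℂ))
    simp_rw [fun n t => inner_ind (eps_pos n) t hab] at h1
    convert h1 using 2
    rw [L2.inner_indicatorConstLp_one, intervalIntegral.integral_of_le hab]
    have hi : Integrable (fun x => g x) (volume.restrict (Ioc a b)) := by
      have : MemLp g 2 (volume.restrict (Ioc a b)) := (Lp.memLp g).restrict _
      exact this.integrable (by norm_num)
    have := integral_re hi
    simp only [RCLike.re_eq_complex_re] at this
    exact this

lemma log_kz_bound {ε : ℝ} (hε : 0 < ε) (hε1 : ε ≤ 1) {x t : ℝ} (hxt : t ≠ x) :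
    |Real.log ‖kz t ε x‖| ≤ |Real.log (|x - t|)| + Real.log 2 := by
  have h0 : 0 < |x - t| := abs_pos.2 (sub_ne_zero.2 hxt.symm)
  have hn : 0 < ‖kz t ε x‖ := norm_pos_iff.2 (kz_ne t hε.ne' x)
  have hlow : |x - t| ≤ ‖kz t ε x‖ := by
    have := Complex.abs_re_le_norm (kz t ε x)
    rwa [kz_re] at this
  have hup : ‖kz t ε x‖ ≤ |x - t| + 1 := by
    have := Complex.norm_le_abs_re_add_abs_im (kz t ε x)
    rw [kz_re, kz_im, abs_of_pos hε] at this
    linarith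
  have hl2 : 0 ≤ Real.log 2 := Real.log_nonneg (by norm_num)
  have h1 : Real.log (|x - t|) ≤ Real.log ‖kz t ε x‖ := Real.log_le_log h0 hlow
  rw [abs_le]
  constructor
  · have := neg_abs_le (Real.log (|x - t|)); linarith
  · rcases le_total 1 |x - t| with h | h
    · have : Real.log ‖kz t ε x‖ ≤ Real.log (2 * |x - t|) := Real.log_le_log hn (by linarith)
      rw [Real.log_mul (by norm_num) h0.ne'] at this
      have := le_abs_self (Real.log (|x - t|)); linarith
    · have : Real.log ‖kz t ε x‖ ≤ Real.log 2 := Real.log_le_log hn (by linarith)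
      have := abs_nonneg (Real.log (|x - t|)); linarith

lemma pot_tendsto {f : ℝ → ℝ} (hc : Continuous f) (hf : Integrable f) (x : ℝ)
    (hU : Integrable fun t => f t * Real.log (|x - t|)) :
    Tendsto (fun n => ∫ t, f t * Real.log ‖kz t (eps n) x‖) atTop
      (nhds (∫ t, f t * Real.log (|x - t|))) ∧
    ∀ n, Integrable fun t => f t * Real.log ‖kz t (eps n) x‖ := by
  have hm : ∀ n, AEStronglyMeasurable (fun t => f t * Real.log ‖kz t (eps n) x‖) volume := by
    intro n
    refine (hc.mul (Continuous.log ?_ fun t =>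
      (norm_pos_iff.2 (kz_ne t (eps_pos n).ne' x)).ne')).aestronglyMeasurable
    unfold kz; fun_prop
  have hne : ∀ᵐ t : ℝ, t ≠ x := by
    simp [ae_iff, measure_singleton]
  have hb : ∀ n, ∀ᵐ t, ‖f t * Real.log ‖kz t (eps n) x‖‖ ≤
      ‖f t * Real.log (|x - t|)‖ + ‖f t‖ * Real.log 2 := by
    intro n
    filter_upwards [hne] with t ht
    rw [norm_mul, norm_mul, ← mul_add]
    refine mul_le_mul_of_nonneg_left ?_ (norm_nonneg _)
    refine log_kz_bound (eps_pos n) ?_ ht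
    unfold eps
    rw [div_le_one (by positivity)]
    have : (0 : ℝ) ≤ n := by positivity
    linarith
  have hbi : Integrable fun t => ‖f t * Real.log (|x - t|)‖ + ‖f t‖ * Real.log 2 :=
    hU.norm.add (hf.norm.mul_const _)
  refine ⟨?_, fun n => hbi.mono' (hm n) (hb n)⟩
  refine tendsto_integral_of_dominated_convergence _ hm hbi hb ?_
  filter_upwards [hne] with t ht
  refine Tendsto.const_mul _ ?_
  have h0 : 0 < |x - t| := abs_pos.2 (sub_ne_zero.2 ht.symm)
  refine Tendsto.log ?_ h0.ne'
  have : Continuous fun ε : ℝ => ‖kz t ε x‖ := by unfold kz; fun_prop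
  have h2 := (this.tendsto 0).comp eps_tendsto
  have h3 : ‖kz t 0 x‖ = |x - t| := by
    simp only [kz, Complex.ofReal_zero, zero_mul, add_zero, Complex.norm_real, Real.norm_eq_abs]
  rw [h3] at h2
  exact h2

theorem integral_density_mul_deriv_eq_zero
    (V h : ℝ → ℝ)
    (hV : AnalyticOnNhd ℝ V Set.univ)
    (hh : AnalyticOnNhd ℝ h Set.univ)
    (hhint : Integrable (fun t => max (h t) 0))
    (μ : Measure ℝ)
    (hμ : μ = MeasureTheory.volume.withDensity
      (fun t => ENNReal.ofReal ((1 / Real.pi) * Real.sqrt (max (h t) 0))))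
    (hprob : IsProbabilityMeasure μ)
    (hUdef : ∀ x : ℝ, Integrable (fun t => Real.log (1 / |x - t|)) μ)
    (F : ℝ)
    (heq : ∀ x ∈ measSupport μ, (∫ t, Real.log (1 / |x - t|) ∂μ) + V x = F)
    (hge : ∀ x : ℝ, F ≤ (∫ t, Real.log (1 / |x - t|) ∂μ) + V x) :
    Integrable (fun t => Real.sqrt (max (h t) 0) * deriv V t) ∧
    ∫ t : ℝ, Real.sqrt (max (h t) 0) * deriv V t = 0 := by
  have hhc : Continuous h := continuous_iff_continuousAt.2 fun x => (hh x (mem_univ x)).continuousAt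
  have hVd : ∀ x, HasDerivAt V (deriv V x) x := fun x =>
    (hV x (mem_univ x)).differentiableAt.hasDerivAt
  set f : ℝ → ℝ := fun t => Real.sqrt (max (h t) 0) with hfdef
  have hf0 : ∀ t, 0 ≤ f t := fun t => Real.sqrt_nonneg _
  have hfc : Continuous f := (hhc.max continuous_const).sqrt
  have hf2 : MemLp f 2 volume := by
    rw [memLp_two_iff_integrable_sq hfc.aestronglyMeasurable]
    refine hhint.congr (Eventually.of_forall fun t => ?_)
    simp only [hfdef]
    rw [Real.sq_sqrt (le_max_right _ _)]
  have hdm : Measurable fun t => ENNReal.ofReal ((1 / π) * f t) := by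
    exact (hfc.measurable.const_mul _).ennreal_ofReal
  have hdlt : ∀ᵐ t : ℝ, ENNReal.ofReal ((1 / π) * f t) < ⊤ :=
    Eventually.of_forall fun t => ENNReal.ofReal_lt_top
  have hd : ∀ t, (ENNReal.ofReal ((1 / π) * f t)).toReal = (1 / π) * f t := fun t =>
    ENNReal.toReal_ofReal (mul_nonneg (by positivity) (hf0 t))
  have hμint : ∀ g : ℝ → ℝ, Integrable g μ → Integrable fun t => f t * g t := by
    intro g hg
    rw [hμ, integrable_withDensity_iff_integrable_smul₀' hdm.aemeasurable hdlt] at hg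
    refine (hg.const_mul π).congr (Eventually.of_forall fun t => ?_)
    simp only [smul_eq_mul]
    rw [hd]; field_simp
  have hf1 : Integrable f := by simpa using hμint (fun _ => 1) (integrable_const _)
  have hlog : ∀ x t : ℝ, Real.log (1 / |x - t|) = - Real.log (|x - t|) := by
    intro x t; rw [one_div, Real.log_inv]
  simp_rw [hlog] at hUdef heq
  have hU : ∀ x, Integrable fun t => f t * Real.log (|x - t|) := fun x => by
    simpa using (hμint _ (hUdef x)).neg
  have hUeq : ∀ x, ∫ t, - Real.log (|x - t|) ∂μ = -(1 / π) * ∫ t, f t * Real.log (|x - t|) := by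
    intro x
    rw [hμ, integral_withDensity_eq_integral_toReal_smul hdm hdlt, ← integral_const_mul]
    congr 1; ext t
    rw [hd, smul_eq_mul]; ring
  have hsupp : ∀ x, 0 < h x → x ∈ measSupport μ := by
    intro x hx U hU
    have hO : IsOpen {y | 0 < h y} := isOpen_lt continuous_const hhc
    have hN : U ∩ {y | 0 < h y} ∈ nhds x := inter_mem hU (hO.mem_nhds hx)
    obtain ⟨W, hWsub, hWo, hxW⟩ := mem_nhds_iff.1 hN
    refine lt_of_lt_of_le ?_ (measure_mono (hWsub.trans inter_subset_left))
    rw [pos_iff_ne_zero, hμ]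
    intro h0
    rw [withDensity_apply_eq_zero hdm] at h0
    have hsub : W ⊆ {t | ENNReal.ofReal ((1 / π) * f t) ≠ 0} ∩ W := by
      intro y hy
      refine ⟨?_, hy⟩
      have hy' : 0 < h y := (hWsub hy).2
      have : 0 < f y := Real.sqrt_pos.2 (lt_max_of_lt_left hy')
      have : 0 < (1 / π) * f y := by positivity
      exact (ENNReal.ofReal_pos.2 this).ne'
    have h1 := measure_mono_null hsub h0
    exact (hWo.measure_pos volume ⟨x, hxW⟩).ne' h1
  obtain ⟨r, hr2, hr0, hrlim⟩ := hilbert_main hfc hf1 hf2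
  have hab : ∀ a b, a ≤ b → 0 < h a → 0 < h b → ∫ x in a..b, r x = π * (V b - V a) := by
    intro a b hab ha hb
    refine tendsto_nhds_unique (hrlim a b hab) ?_
    obtain ⟨ta, ia⟩ := pot_tendsto hfc hf1 a (hU a)
    obtain ⟨tb, ib⟩ := pot_tendsto hfc hf1 b (hU b)
    have h1 := tb.sub ta
    have ea := heq a (hsupp a ha)
    have eb := heq b (hsupp b hb)
    rw [hUeq] at ea eb
    have e : π * (V b - V a) = (∫ t, f t * Real.log (|b - t|)) - ∫ t, f t * Real.log (|a - t|) := by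
      have e1 : V b - V a =
          (1 / π) * ((∫ t, f t * Real.log (|b - t|)) - ∫ t, f t * Real.log (|a - t|)) := by
        linarith
      rw [e1]; field_simp
    rw [e]
    refine h1.congr fun n => ?_
    rw [← integral_sub (ib n) (ia n)]
    congr 1; ext t; ring
  have hloc : LocallyIntegrable r volume := hr2.locallyIntegrable (by norm_num)
  have hae : ∀ᵐ x, f x * deriv V x = (1 / π) * (f x * r x) := by
    filter_upwards [_root_.LocallyIntegrable.ae_hasDerivAt_integral hloc] with x hx
    by_cases hpos : 0 < h x
    · have hO : IsOpen {y | 0 < h y} := isOpen_lt continuous_const hhc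
      have hev : (fun u => ∫ t in x..u, r t) =ᶠ[nhds x] fun u => π * (V u - V x) := by
        filter_upwards [hO.mem_nhds hpos] with u hu
        have hu' : 0 < h u := hu
        rcases le_total x u with hxu | hxu
        · exact hab x u hxu hpos hu'
        · rw [intervalIntegral.integral_symm, hab u x hxu hu' hpos]; ring
      have hd1 := (hx x).congr_of_eventuallyEq hev.symm
      have hd2 := ((hVd x).sub_const (V x)).const_mul π
      rw [hd1.unique hd2]; field_simp
    · have : f x = 0 := by
        simp only [hfdef]
        rw [max_eq_right (not_lt.1 hpos), Real.sqrt_zero]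
      rw [this]; simp
  have hfr : Integrable fun x => f x * r x := hf2.integrable_mul hr2
  constructor
  · exact (hfr.const_mul (1 / π)).congr (hae.mono fun x hx => hx.symm)
  · rw [integral_congr_ae hae, integral_const_mul, hr0, mul_zero]
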